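/- arXiv:2103.01658 — 6 statements merged into one kernel-verified Lean document; each statement's English description precedes it below -/
import Mathlib

section
/- Let X and U be finite nonempty sets, let P0, P1 : X × U → Δ(X) be transition kernels, let π0, π1 : X → Δ(U) be policies, and let μ ∈ Δ(X) be a stationary distribution of the closed-loop kernel P1^{π1}, i.e., ∑_{x∈X} P1^{π1}(y|x) μ(x) = μ(y) for all y ∈ X. Assume that for every x in the support of μ, π1(·|x) is absolutely continuous with respect to π0(·|x), and that for every (x,u) with μ(x)π1(u|x) > 0, P1(·|x,u) is absolutely continuous with respect to P0(·|x,u). Then ∑_{x∈X} ∑_{u∈U} μ(x) π1(u|x) ∑_{y∈X} ∑_{a∈U} π1(a|y) P1(y|x,u) · ln[(π1(a|y) P1(y|x,u)) / (π0(a|y) P0(y|x,u))] = ∑_{x∈X} ∑_{u∈U} μ(x) π1(u|x) D(P1(·|x,u), P0(·|x,u)) + ∑_{x∈X} μ(x) D(π1(·|x), π0(·|x)). -/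
/-- the full-information privacy quantity `I_F(π0,π1)` of Theorem 1
decomposes as the stationary-average KL divergence of the transition kernels plus
the stationary-average KL divergence of the policies. -/
theorem stmt1 {X U : Type*} [Fintype X] [Fintype U] [Nonempty X] [Nonempty U]
    (P0 P1 : X → U → X → ℝ) (pol0 pol1 : X → U → ℝ) (μ : X → ℝ)
    (hP0nn : ∀ x u y, 0 ≤ P0 x u y) (hP0sum : ∀ x u, ∑ y, P0 x u y = 1)
    (hP1nn : ∀ x u y, 0 ≤ P1 x u y) (hP1sum : ∀ x u, ∑ y, P1 x u y = 1)
    (hpol0nn : ∀ x u, 0 ≤ pol0 x u) (hpol0sum : ∀ x, ∑ u, pol0 x u = 1)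
    (hpol1nn : ∀ x u, 0 ≤ pol1 x u) (hpol1sum : ∀ x, ∑ u, pol1 x u = 1)
    (hμnn : ∀ x, 0 ≤ μ x) (hμsum : ∑ x, μ x = 1)
    (hμstat : ∀ y, ∑ x, (∑ u, P1 x u y * pol1 x u) * μ x = μ y)
    (hacPol : ∀ x, 0 < μ x → ∀ u, pol0 x u = 0 → pol1 x u = 0)
    (hacP : ∀ x u, 0 < μ x * pol1 x u → ∀ y, P0 x u y = 0 → P1 x u y = 0) :
    ∑ x, ∑ u, μ x * pol1 x u * ∑ y, ∑ a, pol1 y a * P1 x u y *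
        Real.log ((pol1 y a * P1 x u y) / (pol0 y a * P0 x u y)) =
      (∑ x, ∑ u, μ x * pol1 x u *
          ∑ y, P1 x u y * Real.log (P1 x u y / P0 x u y)) +
        ∑ x, μ x * ∑ u, pol1 x u * Real.log (pol1 x u / pol0 x u) := by
  set K : X → ℝ := fun y => ∑ a, pol1 y a * Real.log (pol1 y a / pol0 y a) with hK
  have hμpos : ∀ x u y, 0 < μ x * pol1 x u → 0 < P1 x u y → 0 < μ y := by
    intro x u y hw hP
    rw [← hμstat y]
    have hnn : ∀ x', 0 ≤ ∑ u', P1 x' u' y * pol1 x' u' := fun x' =>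
      Finset.sum_nonneg fun u' _ => mul_nonneg (hP1nn x' u' y) (hpol1nn x' u')
    calc 0 < P1 x u y * (μ x * pol1 x u) := mul_pos hP hw
      _ = (P1 x u y * pol1 x u) * μ x := by ring
      _ ≤ (∑ u', P1 x u' y * pol1 x u') * μ x :=
        mul_le_mul_of_nonneg_right
          (Finset.single_le_sum (f := fun u' => P1 x u' y * pol1 x u')
            (fun u' _ => mul_nonneg (hP1nn x u' y) (hpol1nn x u')) (Finset.mem_univ u))
          (hμnn x)
      _ ≤ _ := Finset.single_le_sum (f := fun x' => (∑ u', P1 x' u' y * pol1 x' u') * μ x')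
            (fun x' _ => mul_nonneg (hnn x') (hμnn x')) (Finset.mem_univ x)
  have hchain : ∀ x u, μ x * pol1 x u * ∑ y, ∑ a, pol1 y a * P1 x u y *
        Real.log ((pol1 y a * P1 x u y) / (pol0 y a * P0 x u y)) =
      μ x * pol1 x u * ∑ y, P1 x u y * Real.log (P1 x u y / P0 x u y) +
        μ x * pol1 x u * ∑ y, P1 x u y * K y := by
    intro x u
    rcases (mul_nonneg (hμnn x) (hpol1nn x u)).eq_or_lt with hw | hw
    · simp [← hw]
    rw [← mul_add, ← Finset.sum_add_distrib]
    congr 1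
    refine Finset.sum_congr rfl fun y _ => ?_
    rcases (hP1nn x u y).eq_or_lt with hP | hP
    · simp [← hP]
    have hP0 : P0 x u y ≠ 0 := fun h => hP.ne' (hacP x u hw y h)
    have hμy := hμpos x u y hw hP
    calc _ = ∑ a, (pol1 y a * (P1 x u y * Real.log (P1 x u y / P0 x u y)) +
          P1 x u y * (pol1 y a * Real.log (pol1 y a / pol0 y a))) := by
          refine Finset.sum_congr rfl fun a _ => ?_
          by_cases ha : pol1 y a = 0
          · simp [ha]
          have ha0 : pol0 y a ≠ 0 := fun h => ha (hacPol y hμy a h)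
          rw [mul_div_mul_comm, Real.log_mul (div_ne_zero ha ha0) (div_ne_zero hP.ne' hP0)]
          ring
      _ = _ := by
          rw [Finset.sum_add_distrib, ← Finset.sum_mul, hpol1sum, one_mul, ← Finset.mul_sum]
  have hstat : ∑ x, ∑ u, μ x * pol1 x u * ∑ y, P1 x u y * K y = ∑ y, μ y * K y := by
    calc _ = ∑ x, ∑ y, ∑ u, P1 x u y * pol1 x u * μ x * K y := by
          refine Finset.sum_congr rfl fun x _ => ?_
          rw [Finset.sum_comm]
          refine Finset.sum_congr rfl fun u _ => ?_
          rw [Finset.mul_sum]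
          exact Finset.sum_congr rfl fun y _ => by ring
      _ = ∑ y, ∑ x, ∑ u, P1 x u y * pol1 x u * μ x * K y := Finset.sum_comm
      _ = _ := by
          refine Finset.sum_congr rfl fun y _ => ?_
          conv_rhs => rw [← hμstat y]
          simp only [Finset.sum_mul]
  simp only [hchain, Finset.sum_add_distrib]
  rw [hstat]
end

section
/- Let X and U be finite nonempty sets and P0, P1 : X × U → Δ(X) transition kernels with P1(·|x,u) absolutely continuous with respect to P0(·|x,u) for all (x,u). Assume ergodicity: every policy π1 admits a unique stationary distribution μ^{π1} for P1^{π1}, and μ^{π1}(x) > 0 for all x. For policies π0, π1 with π1(·|x) ≪ π0(·|x) for all x, set I_F(π0,π1) = ∑_{x,u} μ^{π1}(x) π1(u|x) D(P1(·|x,u), P0(·|x,u)) + ∑_x μ^{π1}(x) D(π1(·|x), π0(·|x)). Then the infimum of I_F(π0,π1) over all such pairs (π0,π1) equals the minimum of ∑_{x,u} ξ(x,u) D(P1(·|x,u), P0(·|x,u)) over all ξ ∈ Δ(X × U) satisfying ∑_{x,u} ξ(x,u) P1(y|x,u) = ∑_u ξ(y,u) for all y ∈ X; and this infimum is attained by taking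 π1(u|x) = ξ*(x,u)/∑_{u'} ξ*(x,u') for an optimal ξ* and π0 = π1. -/
/-- KL divergence between two finite probability vectors (with the convention
`0 · ln(0/c) = 0` inherited from `Real.log`). -/
noncomputable def klD {X : Type*} [Fintype X] (p q : X → ℝ) : ℝ :=
  ∑ y, p y * Real.log (p y / q y)

/-- A (randomized) policy on finite state and action spaces. -/
def IsPolicy {X U : Type*} [Fintype U] (pol : X → U → ℝ) : Prop :=
  (∀ x u, 0 ≤ pol x u) ∧ ∀ x, ∑ u, pol x u = 1

/-- A probability distribution on a finite set. -/
def IsDist {X : Type*} [Fintype X] (μ : X → ℝ) : Prop :=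
  (∀ x, 0 ≤ μ x) ∧ ∑ x, μ x = 1

/-- The full-information privacy quantity `I_F(π0,π1)` evaluated with the
stationary distribution `μ` of the closed loop `P1^{π1}`. -/
noncomputable def IFull {X U : Type*} [Fintype X] [Fintype U]
    (P0 P1 : X → U → X → ℝ) (μ : X → ℝ) (pol0 pol1 : X → U → ℝ) : ℝ :=
  (∑ x, ∑ u, μ x * pol1 x u * klD (P1 x u) (P0 x u)) +
    ∑ x, μ x * klD (pol1 x) (pol0 x)

/-- The occupation measures of the kernel `P`: the feasible set of the linear program. -/
def occupationMeasures {X U : Type*} [Fintype X] [Fintype U] (P : X → U → X → ℝ) :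
    Set (X → U → ℝ) :=
  {ξ | (∀ x u, 0 ≤ ξ x u) ∧ ∑ x, ∑ u, ξ x u = 1 ∧
    ∀ y, ∑ x, ∑ u, ξ x u * P x u y = ∑ u, ξ y u}

lemma klD_self {Y : Type*} [Fintype Y] (p : Y → ℝ) : klD p p = 0 := by
  refine Finset.sum_eq_zero fun y _ => ?_
  rcases eq_or_ne (p y) 0 with h | h <;> simp [h]

lemma klD_nonneg {Y : Type*} [Fintype Y] {p q : Y → ℝ} (hp : IsDist p) (hq : IsDist q)
    (hac : ∀ y, q y = 0 → p y = 0) : 0 ≤ klD p q := by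
  have h : ∑ y, (p y - q y) ≤ klD p q := by
    refine Finset.sum_le_sum fun y _ => ?_
    rcases (hp.1 y).eq_or_lt with h0 | hpos
    · simpa [← h0] using hq.1 y
    · have hqpos : 0 < q y := (hq.1 y).lt_of_ne fun h => hpos.ne' (hac y h.symm)
      have hlog := mul_le_mul_of_nonneg_left
        (Real.one_sub_inv_le_log_of_pos (div_pos hpos hqpos)) hpos.le
      have hleft : p y * (1 - (p y / q y)⁻¹) = p y - q y := by field_simp
      linarith
  simpa [Finset.sum_sub_distrib, hp.2, hq.2] using h

lemma IsPolicy.isDist {X U : Type*} [Fintype U] {pol : X → U → ℝ} (h : IsPolicy pol) (x : X) : IsDist (pol x) :=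
  ⟨h.1 x, h.2 x⟩

lemma isPolicy_uniform {X U : Type*} [Fintype U] [Nonempty U] :
    IsPolicy (fun (_ : X) (_ : U) => (Fintype.card U : ℝ)⁻¹) :=
  ⟨fun _ _ => by positivity, fun _ => by simp⟩

lemma exists_isPolicy_disintegration {X U : Type*} [Fintype U] [Nonempty U]
    {ξ : X → U → ℝ} (hξ : ∀ x u, 0 ≤ ξ x u) :
    ∃ pol : X → U → ℝ, IsPolicy pol ∧ ∀ x u, (∑ u', ξ x u') * pol x u = ξ x u := by
  classical
  refine ⟨fun x u => if ∑ u', ξ x u' = 0 then (Fintype.card U : ℝ)⁻¹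
    else ξ x u / ∑ u', ξ x u', ⟨fun x u => ?_, fun x => ?_⟩, fun x u => ?_⟩
  · beta_reduce
    split_ifs
    · positivity
    · exact div_nonneg (hξ x u) (Finset.sum_nonneg fun u _ => hξ x u)
  · beta_reduce
    split_ifs with h
    · simp
    · rw [← Finset.sum_div, div_self h]
  · beta_reduce
    split_ifs with h
    · rw [h, zero_mul, (Finset.sum_eq_zero_iff_of_nonneg fun u _ => hξ x u).1 h u
        (Finset.mem_univ u)]
    · exact mul_div_cancel₀ _ h

section

variable {X U : Type*} [Fintype X] [Fintype U] {P : X → U → X → ℝ}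

lemma isCompact_occupationMeasures : IsCompact (occupationMeasures P) := by
  refine (isCompact_Icc (a := (0 : X → U → ℝ)) (b := 1)).of_isClosed_subset ?_ ?_
  · simp only [occupationMeasures, Set.ofPred_and, Set.ofPred_forall]
    refine .inter (isClosed_iInter fun x => isClosed_iInter fun u => ?_)
      (.inter ?_ (isClosed_iInter fun y => ?_))
    · exact isClosed_le (by fun_prop) (by fun_prop)
    · exact isClosed_eq (by fun_prop) (by fun_prop)
    · exact isClosed_eq (by fun_prop) (by fun_prop)
  · rintro ξ ⟨hnn, hsum, -⟩
    refine ⟨hnn, fun x u => ?_⟩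
    calc ξ x u ≤ ∑ u, ξ x u :=
          Finset.single_le_sum (fun u _ => hnn x u) (Finset.mem_univ u)
      _ ≤ ∑ x, ∑ u, ξ x u :=
          Finset.single_le_sum (f := fun x => ∑ u, ξ x u)
            (fun x _ => Finset.sum_nonneg fun u _ => hnn x u) (Finset.mem_univ x)
      _ = 1 := hsum

lemma mul_mem_occupationMeasures {pol : X → U → ℝ} {μ : X → ℝ} (hpol : IsPolicy pol)
    (hμ : IsDist μ) (hst : ∀ y, ∑ x, (∑ u, P x u y * pol x u) * μ x = μ y) :
    (fun x u => μ x * pol x u) ∈ occupationMeasures P := by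
  refine ⟨fun x u => mul_nonneg (hμ.1 x) (hpol.1 x u), ?_, fun y => ?_⟩
  · simp [← Finset.mul_sum, hpol.2, hμ.2]
  · rw [← Finset.mul_sum, hpol.2, mul_one, ← hst y]
    refine Finset.sum_congr rfl fun x _ => ?_
    rw [Finset.sum_mul]
    exact Finset.sum_congr rfl fun u _ => by ring

/-- If `pol` disintegrates an occupation measure `ξ`, then the state marginal of `ξ` is
stationary. -/
lemma stationary_marginal {ξ pol : X → U → ℝ} (hξ : ξ ∈ occupationMeasures P)
    (hdis : ∀ x u, (∑ u', ξ x u') * pol x u = ξ x u) (y : X) :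
    ∑ x, (∑ u, P x u y * pol x u) * (∑ u, ξ x u) = ∑ u, ξ y u := by
  rw [← hξ.2.2 y]
  refine Finset.sum_congr rfl fun x _ => ?_
  rw [Finset.sum_mul]
  refine Finset.sum_congr rfl fun u _ => ?_
  rw [← hdis x u]
  ring

lemma isDist_marginal {ξ : X → U → ℝ} (hξ : ξ ∈ occupationMeasures P) :
    IsDist fun x => ∑ u, ξ x u :=
  ⟨fun x => Finset.sum_nonneg fun u _ => hξ.1 x u, hξ.2.1⟩

end

/-- Proposition 1: under ergodicity, the best full-information privacy
level `inf I_F(π0,π1)` equals the value of the linear program over occupation measures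
`ξ` with objective `∑ ξ(x,u) D(P1(·|x,u),P0(·|x,u))`, and the infimum is attained at
the policy induced by an optimal `ξ*`, with `π0 = π1`. -/
theorem stmt4 {X U : Type*} [Fintype X] [Fintype U] [Nonempty X] [Nonempty U]
    (P0 P1 : X → U → X → ℝ)
    (hP0nn : ∀ x u y, 0 ≤ P0 x u y) (hP0sum : ∀ x u, ∑ y, P0 x u y = 1)
    (hP1nn : ∀ x u y, 0 ≤ P1 x u y) (hP1sum : ∀ x u, ∑ y, P1 x u y = 1)
    (hPac : ∀ x u y, P0 x u y = 0 → P1 x u y = 0)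
    (stat : (X → U → ℝ) → X → ℝ)
    (hstat : ∀ pol, IsPolicy pol →
      IsDist (stat pol) ∧ (∀ x, 0 < stat pol x) ∧
      (∀ y, ∑ x, (∑ u, P1 x u y * pol x u) * stat pol x = stat pol y) ∧
      (∀ μ' : X → ℝ, IsDist μ' →
        (∀ y, ∑ x, (∑ u, P1 x u y * pol x u) * μ' x = μ' y) → μ' = stat pol)) :
    sInf {r : ℝ | ∃ pol0 pol1 : X → U → ℝ, IsPolicy pol0 ∧ IsPolicy pol1 ∧
        (∀ x u, pol0 x u = 0 → pol1 x u = 0) ∧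
        r = IFull P0 P1 (stat pol1) pol0 pol1} =
      sInf {r : ℝ | ∃ ξ : X → U → ℝ, (∀ x u, 0 ≤ ξ x u) ∧ (∑ x, ∑ u, ξ x u = 1) ∧
        (∀ y, ∑ x, ∑ u, ξ x u * P1 x u y = ∑ u, ξ y u) ∧
        r = ∑ x, ∑ u, ξ x u * klD (P1 x u) (P0 x u)} ∧
    ∃ ξ : X → U → ℝ, (∀ x u, 0 ≤ ξ x u) ∧ (∑ x, ∑ u, ξ x u = 1) ∧
      (∀ y, ∑ x, ∑ u, ξ x u * P1 x u y = ∑ u, ξ y u) ∧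
      (∀ x, 0 < ∑ u, ξ x u) ∧
      IsLeast {r : ℝ | ∃ ξ' : X → U → ℝ, (∀ x u, 0 ≤ ξ' x u) ∧
          (∑ x, ∑ u, ξ' x u = 1) ∧
          (∀ y, ∑ x, ∑ u, ξ' x u * P1 x u y = ∑ u, ξ' y u) ∧
          r = ∑ x, ∑ u, ξ' x u * klD (P1 x u) (P0 x u)}
        (∑ x, ∑ u, ξ x u * klD (P1 x u) (P0 x u)) ∧
      IFull P0 P1 (stat (fun x u => ξ x u / ∑ u', ξ x u'))
          (fun x u => ξ x u / ∑ u', ξ x u') (fun x u => ξ x u / ∑ u', ξ x u') =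
        sInf {r : ℝ | ∃ pol0 pol1 : X → U → ℝ, IsPolicy pol0 ∧ IsPolicy pol1 ∧
          (∀ x u, pol0 x u = 0 → pol1 x u = 0) ∧
          r = IFull P0 P1 (stat pol1) pol0 pol1} := by
  have hpos : ∀ ξ ∈ occupationMeasures P1, ∀ x, 0 < ∑ u, ξ x u := by
    intro ξ hξ x
    obtain ⟨pol, hpol, hdis⟩ := exists_isPolicy_disintegration hξ.1
    have h := (hstat pol hpol).2.2.2 _ (isDist_marginal hξ) (stationary_marginal hξ hdis)
    exact (congrFun h x).symm ▸ (hstat pol hpol).2.1 x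
  have hocc : ∀ pol, IsPolicy pol →
      (fun x u => stat pol x * pol x u) ∈ occupationMeasures P1 := fun pol hpol =>
    mul_mem_occupationMeasures hpol (hstat pol hpol).1 (hstat pol hpol).2.2.1
  obtain ⟨ξ, hξ, hmin⟩ := isCompact_occupationMeasures.exists_isMinOn
    ⟨_, hocc _ isPolicy_uniform⟩
    (f := fun ξ : X → U → ℝ => ∑ x, ∑ u, ξ x u * klD (P1 x u) (P0 x u))
    (by fun_prop)
  have hm := hpos ξ hξ
  have hLP : IsLeast {r : ℝ | ∃ ξ' : X → U → ℝ, (∀ x u, 0 ≤ ξ' x u) ∧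
      (∑ x, ∑ u, ξ' x u = 1) ∧
      (∀ y, ∑ x, ∑ u, ξ' x u * P1 x u y = ∑ u, ξ' y u) ∧
      r = ∑ x, ∑ u, ξ' x u * klD (P1 x u) (P0 x u)}
      (∑ x, ∑ u, ξ x u * klD (P1 x u) (P0 x u)) := by
    refine ⟨⟨ξ, hξ.1, hξ.2.1, hξ.2.2, rfl⟩, ?_⟩
    rintro r ⟨ξ', h1, h2, h3, rfl⟩
    exact hmin ⟨h1, h2, h3⟩
  have hdis : ∀ x u, (∑ u', ξ x u') * (ξ x u / ∑ u', ξ x u') = ξ x u :=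
    fun x u => mul_div_cancel₀ _ (hm x).ne'
  have hpol : IsPolicy fun x u => ξ x u / ∑ u', ξ x u' :=
    ⟨fun x u => div_nonneg (hξ.1 x u) (hm x).le,
      fun x => by rw [← Finset.sum_div, div_self (hm x).ne']⟩
  have hval : IFull P0 P1 (stat (fun x u => ξ x u / ∑ u', ξ x u'))
      (fun x u => ξ x u / ∑ u', ξ x u') (fun x u => ξ x u / ∑ u', ξ x u') =
      ∑ x, ∑ u, ξ x u * klD (P1 x u) (P0 x u) := by
    rw [← (hstat _ hpol).2.2.2 _ (isDist_marginal hξ) (stationary_marginal hξ hdis)]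
    simp only [IFull, klD_self, mul_zero, Finset.sum_const_zero, add_zero, hdis]
  have hFull : IsLeast {r : ℝ | ∃ pol0 pol1 : X → U → ℝ, IsPolicy pol0 ∧ IsPolicy pol1 ∧
      (∀ x u, pol0 x u = 0 → pol1 x u = 0) ∧
      r = IFull P0 P1 (stat pol1) pol0 pol1}
      (∑ x, ∑ u, ξ x u * klD (P1 x u) (P0 x u)) := by
    refine ⟨⟨_, _, hpol, hpol, fun _ _ h => h, hval.symm⟩, ?_⟩
    rintro r ⟨pol0, pol1, h0, h1, hac, rfl⟩
    refine (hmin (hocc pol1 h1)).trans (le_add_of_nonneg_right ?_)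
    exact Finset.sum_nonneg fun x _ => mul_nonneg ((hstat pol1 h1).1.1 x)
      (klD_nonneg (h1.isDist x) (h0.isDist x) (hac x))
  exact ⟨hFull.csInf_eq.trans hLP.csInf_eq.symm, ξ, hξ.1, hξ.2.1, hξ.2.2, hm, hLP,
    hval.trans hFull.csInf_eq.symm⟩
end

section
/- Let X and U be finite nonempty sets, P0, P1 : X × U → Δ(X) transition kernels with strictly positive entries. Let ξ¹ ∈ Δ(X × U) have strictly positive row sums, define π1(u|x) = ξ¹(x,u)/‖ξ¹_{x,*}‖₁ and μ1(x) = ‖ξ¹_{x,*}‖₁, and let α : X → Δ(U) be a policy (denoting α(u|x) = α_{x,u}). Then ∑_{x∈X} μ1(x) D(P1^{π1}(·|x), P0^{α}(·|x)) = − ∑_{x∈X} ‖ξ¹_{x,*}‖₁ ln ‖ξ¹_{x,*}‖₁ + ∑_{x∈X} ∑_{y∈X} (∑_{u∈U} P1(y|x,u) ξ¹(x,u)) · ln[ (∑_{u'∈U} P1(y|x,u') ξ¹(x,u')) / (∑_{u'∈U} P0(y|x,u') α_{x,u'}) ]. -/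
theorem sum_mul_pos_of_sum_pos {U : Type*} [Fintype U] {p w : U → ℝ}
    (hp : ∀ u, 0 < p u) (hw : ∀ u, 0 ≤ w u) (hsum : 0 < ∑ u, w u) :
    0 < ∑ u, p u * w u := by
  obtain ⟨u, hu, hwu⟩ := (Finset.sum_pos_iff_of_nonneg fun u _ => hw u).1 hsum
  exact Finset.sum_pos' (fun v _ => mul_nonneg (hp v).le (hw v)) ⟨u, hu, mul_pos (hp u) hwu⟩

/-- Joint kernel mass out of a state is the mass of that state. -/
theorem sum_sum_kernel_mul {X U : Type*} [Fintype X] [Fintype U] {P : U → X → ℝ}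
    (hP : ∀ u, ∑ y, P u y = 1) (w : U → ℝ) :
    ∑ y, ∑ u, P u y * w u = ∑ u, w u := by
  rw [Finset.sum_comm]
  simp only [← Finset.sum_mul, hP, one_mul]

/-- Rescaling the first argument of a relative entropy by its total mass. -/
theorem mul_sum_div_mul_log_div {X : Type*} [Fintype X] {a b : X → ℝ} {m : ℝ}
    (ha : ∀ y, 0 < a y) (hb : ∀ y, 0 < b y) (hm : 0 < m) (hsum : ∑ y, a y = m) :
    m * ∑ y, a y / m * Real.log (a y / m / b y) =
      -(m * Real.log m) + ∑ y, a y * Real.log (a y / b y) := by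
  have key : ∀ y, m * (a y / m * Real.log (a y / m / b y)) =
      -(a y * Real.log m) + a y * Real.log (a y / b y) := by
    intro y
    rw [div_right_comm, Real.log_div (div_pos (ha y) (hb y)).ne' hm.ne']
    field_simp
    ring
  rw [Finset.mul_sum, Finset.sum_congr rfl fun y _ => key y, Finset.sum_add_distrib,
    Finset.sum_neg_distrib, ← Finset.sum_mul, hsum]

/-- decomposition of Proposition 2: in occupation-measure variables,
the limited-information quantity `∑_x μ1(x) D(P1^{π1}(·|x), P0^{α}(·|x))` decomposes
as a difference of convex functions. -/
theorem stmt9 {X U : Type*} [Fintype X] [Fintype U] [Nonempty X] [Nonempty U]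
    (P0 P1 : X → U → X → ℝ)
    (hP0pos : ∀ x u y, 0 < P0 x u y) (hP0sum : ∀ x u, ∑ y, P0 x u y = 1)
    (hP1pos : ∀ x u y, 0 < P1 x u y) (hP1sum : ∀ x u, ∑ y, P1 x u y = 1)
    (ξ1 : X → U → ℝ)
    (hξ1nn : ∀ x u, 0 ≤ ξ1 x u) (hξ1sum : ∑ x, ∑ u, ξ1 x u = 1)
    (hξ1pos : ∀ x, 0 < ∑ u, ξ1 x u)
    (α : X → U → ℝ)
    (hαnn : ∀ x u, 0 ≤ α x u) (hαsum : ∀ x, ∑ u, α x u = 1) :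
    ∑ x, (∑ u, ξ1 x u) *
        ∑ y, (∑ u, P1 x u y * (ξ1 x u / ∑ u', ξ1 x u')) *
          Real.log ((∑ u, P1 x u y * (ξ1 x u / ∑ u', ξ1 x u')) /
            (∑ u, P0 x u y * α x u)) =
      -(∑ x, (∑ u, ξ1 x u) * Real.log (∑ u, ξ1 x u)) +
        ∑ x, ∑ y, (∑ u, P1 x u y * ξ1 x u) *
          Real.log ((∑ u', P1 x u' y * ξ1 x u') / (∑ u', P0 x u' y * α x u')) := by
  rw [← Finset.sum_neg_distrib, ← Finset.sum_add_distrib]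
  refine Finset.sum_congr rfl fun x _ => ?_
  simp only [← mul_div_assoc, ← Finset.sum_div]
  exact mul_sum_div_mul_log_div
    (fun y => sum_mul_pos_of_sum_pos (fun u => hP1pos x u y) (hξ1nn x) (hξ1pos x))
    (fun y => sum_mul_pos_of_sum_pos (fun u => hP0pos x u y) (hαnn x)
      (hαsum x ▸ one_pos))
    (hξ1pos x) (sum_sum_kernel_mul (hP1sum x) (ξ1 x))
end

section
/- Let n, m ≥ 1, let B ∈ ℝ^{n×m} have linearly independent columns, let E ∈ ℝ^{n×n} be symmetric positive definite, let R ∈ ℝ^{m×m} be symmetric positive definite, let F θ ∈ ℝⁿ be a fixed vector, let c ∈ ℝ be a constant, let ρ ∈ [0,1] and λ > 0. Define V_F(α0, α1) = −(1−ρ) α0ᵀ BᵀEB α0 − ρ (Bα1 + Fθ)ᵀ E (Bα1 + Fθ) − (λ/2)( c + (α1−α0)ᵀ R⁻¹ (α1−α0) ) for α0, α1 ∈ ℝ^m, and let T = (I + (2(1−ρ)ρ/λ) E B R Bᵀ) E. Then Bᵀ T B is invertible, and the pair α0* = −ρ (Bᵀ T B)⁻¹ Bᵀ E F θ, α1* =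 (2(1−ρ)/λ · R BᵀEB + I) α0* maximizes V_F over ℝ^m × ℝ^m. -/
open Matrix

/-- Second-order expansion of the quadratic form of a symmetric matrix. -/
lemma dotProduct_mulVec_add_of_isSymm {ι : Type*} [Fintype ι] {S : Matrix ι ι ℝ}
    (hS : S.IsSymm) (x d : ι → ℝ) :
    (x + d) ⬝ᵥ (S *ᵥ (x + d)) =
      x ⬝ᵥ (S *ᵥ x) + 2 * (d ⬝ᵥ (S *ᵥ x)) + d ⬝ᵥ (S *ᵥ d) := by
  have h : x ⬝ᵥ (S *ᵥ d) = d ⬝ᵥ (S *ᵥ x) := by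
    rw [dotProduct_mulVec, ← mulVec_transpose, hS.eq, dotProduct_comm]
  rw [mulVec_add, add_dotProduct, dotProduct_add, dotProduct_add, h]
  ring

lemma Matrix.PosSemidef.dotProduct_mulVec_self_nonneg {ι : Type*} [Fintype ι]
    {S : Matrix ι ι ℝ} (hS : S.PosSemidef) (x : ι → ℝ) : 0 ≤ x ⬝ᵥ (S *ᵥ x) := by
  simpa using hS.dotProduct_mulVec_nonneg x

/-- Proposition 3: the full-information utility-privacy objective
`V_F(α0,α1)` for the linear system is maximized at the stated pair `(α0*, α1*)`. -/
theorem stmt11 {n m : ℕ} (hn : 1 ≤ n) (hm : 1 ≤ m)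
    (B : Matrix (Fin n) (Fin m) ℝ) (hB : LinearIndependent ℝ Bᵀ)
    (E : Matrix (Fin n) (Fin n) ℝ) (hE : E.PosDef)
    (R : Matrix (Fin m) (Fin m) ℝ) (hR : R.PosDef)
    (f : Fin n → ℝ) (c : ℝ) (ρ : ℝ) (hρ : ρ ∈ Set.Icc (0 : ℝ) 1)
    (lam : ℝ) (hlam : 0 < lam)
    (VF : (Fin m → ℝ) → (Fin m → ℝ) → ℝ)
    (hVF : ∀ α0 α1, VF α0 α1 =
      -(1 - ρ) * (α0 ⬝ᵥ ((Bᵀ * E * B) *ᵥ α0)) -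
        ρ * ((B *ᵥ α1 + f) ⬝ᵥ (E *ᵥ (B *ᵥ α1 + f))) -
        lam / 2 * (c + (α1 - α0) ⬝ᵥ (R⁻¹ *ᵥ (α1 - α0))))
    (T : Matrix (Fin n) (Fin n) ℝ)
    (hT : T = (1 + (2 * (1 - ρ) * ρ / lam) • (E * B * R * Bᵀ)) * E) :
    IsUnit (Bᵀ * T * B) ∧
    ∀ α0 α1 : Fin m → ℝ,
      VF α0 α1 ≤
        VF ((-ρ) • (((Bᵀ * T * B)⁻¹ * Bᵀ * E) *ᵥ f))
          ((((2 * (1 - ρ) / lam) • (R * Bᵀ * E * B) + 1)) *ᵥ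
            ((-ρ) • (((Bᵀ * T * B)⁻¹ * Bᵀ * E) *ᵥ f))) := by
  obtain ⟨hρ0, hρ1⟩ := hρ
  have hBinj : Function.Injective B.mulVec := by
    rw [mulVec_injective_iff]
    exact hB
  set M := Bᵀ * E * B with hM
  have hMpos : M.PosDef := by
    simpa [hM] using hE.conjTranspose_mul_mul_same hBinj
  have hEsymm : E.IsSymm := by simpa [IsSymm, IsHermitian] using hE.isHermitian
  have hRinv : (R⁻¹).PosDef := hR.inv
  have hRsymm : (R⁻¹).IsSymm := by simpa [IsSymm, IsHermitian] using hRinv.isHermitian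
  have hMsymm : M.IsSymm := by simpa [IsSymm, IsHermitian] using hMpos.isHermitian
  have hBTB : Bᵀ * T * B = M + (2 * (1 - ρ) * ρ / lam) • (M * R * M) := by
    simp only [hT, hM, Matrix.add_mul, Matrix.mul_add, Matrix.one_mul, Matrix.smul_mul,
      Matrix.mul_smul, Matrix.mul_assoc]
  have hunit : IsUnit (Bᵀ * T * B) := by
    rw [hBTB]
    have hMRM : (M * R * M).PosSemidef := by
      have h := hR.posSemidef.conjTranspose_mul_mul_same M
      rwa [hMpos.isHermitian.eq] at h
    have hk : 0 ≤ 2 * (1 - ρ) * ρ / lam := by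
      have : 0 ≤ 1 - ρ := sub_nonneg.mpr hρ1
      positivity
    exact (hMpos.add_posSemidef (hMRM.smul hk)).isUnit
  refine ⟨hunit, fun α0 α1 => ?_⟩
  set a0 := (-ρ) • (((Bᵀ * T * B)⁻¹ * Bᵀ * E) *ᵥ f) with ha0
  set a1 := (((2 * (1 - ρ) / lam) • (R * Bᵀ * E * B) + 1)) *ᵥ a0 with ha1
  have hdiff : a1 - a0 = (2 * (1 - ρ) / lam) • ((R * M) *ᵥ a0) := by
    simp only [ha1, hM, add_mulVec, one_mulVec, add_sub_cancel_right, smul_mulVec,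
      Matrix.mul_assoc]
  have hstat0 : R⁻¹ *ᵥ (a1 - a0) = (2 * (1 - ρ) / lam) • (M *ᵥ a0) := by
    rw [hdiff, mulVec_smul, mulVec_mulVec,
      nonsing_inv_mul_cancel_left _ _ ((isUnit_iff_isUnit_det _).mp hR.isUnit)]
  have hstatT : M *ᵥ a0 + (2 * (1 - ρ) * ρ / lam) • ((M * R * M) *ᵥ a0) =
      (-ρ) • ((Bᵀ * E) *ᵥ f) := by
    rw [← smul_mulVec, ← add_mulVec, ← hBTB, ha0, mulVec_smul, mulVec_mulVec,
      Matrix.mul_assoc _ Bᵀ E,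
      mul_nonsing_inv_cancel_left _ _ ((isUnit_iff_isUnit_det _).mp hunit)]
  have hstat1 : ρ • (Bᵀ *ᵥ (E *ᵥ (B *ᵥ a1 + f))) = (-(1 - ρ)) • (M *ᵥ a0) := by
    have hMa1 : M *ᵥ a1 = M *ᵥ a0 + (2 * (1 - ρ) / lam) • ((M * R * M) *ᵥ a0) := by
      rw [← sub_add_cancel a1 a0, mulVec_add, hdiff, mulVec_smul, mulVec_mulVec,
        ← Matrix.mul_assoc, add_comm]
    have hexp : Bᵀ *ᵥ (E *ᵥ (B *ᵥ a1 + f)) = M *ᵥ a1 + (Bᵀ * E) *ᵥ f := by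
      simp only [hM, mulVec_add, mulVec_mulVec, Matrix.mul_assoc]
    rw [hexp, hMa1]
    ext i
    have h := congrFun hstatT i
    simp only [Pi.add_apply, Pi.smul_apply, smul_eq_mul] at h ⊢
    linear_combination h
  obtain ⟨d0, rfl⟩ : ∃ d, α0 = a0 + d := ⟨α0 - a0, by simp⟩
  obtain ⟨d1, rfl⟩ : ∃ d, α1 = a1 + d := ⟨α1 - a1, by simp⟩
  have hB1 : B *ᵥ (a1 + d1) + f = (B *ᵥ a1 + f) + B *ᵥ d1 := by
    rw [mulVec_add]
    abel
  have hd : a1 + d1 - (a0 + d0) = (a1 - a0) + (d1 - d0) := by abel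
  have hcross : ρ * ((B *ᵥ d1) ⬝ᵥ (E *ᵥ (B *ᵥ a1 + f))) = -(1 - ρ) * (d1 ⬝ᵥ (M *ᵥ a0)) := by
    have h := congrArg (d1 ⬝ᵥ ·) hstat1
    simp only [dotProduct_smul, smul_eq_mul] at h
    rw [← h, dotProduct_mulVec d1 Bᵀ, vecMul_transpose]
  have hcrossR : lam * ((d1 - d0) ⬝ᵥ (R⁻¹ *ᵥ (a1 - a0))) =
      2 * (1 - ρ) * (d1 ⬝ᵥ (M *ᵥ a0) - d0 ⬝ᵥ (M *ᵥ a0)) := by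
    rw [hstat0, dotProduct_smul, sub_dotProduct, smul_eq_mul]
    field_simp
  rw [hVF, hVF, hB1, hd, dotProduct_mulVec_add_of_isSymm hMsymm,
    dotProduct_mulVec_add_of_isSymm hEsymm, dotProduct_mulVec_add_of_isSymm hRsymm]
  have h0 := mul_nonneg (sub_nonneg.mpr hρ1) (hMpos.posSemidef.dotProduct_mulVec_self_nonneg d0)
  have h1 := mul_nonneg hρ0 (hE.posSemidef.dotProduct_mulVec_self_nonneg (B *ᵥ d1))
  have h2 := mul_nonneg hlam.le (hRinv.posSemidef.dotProduct_mulVec_self_nonneg (d1 - d0))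
  linarith
end

section
/- Let n, m ≥ 1, let B ∈ ℝ^{n×m} have linearly independent columns, let E ∈ ℝ^{n×n} and R ∈ ℝ^{m×m} be symmetric positive definite, let Fθ ∈ ℝⁿ be a fixed vector, and let λ > 0. Then the matrix R BᵀEB + (λ/2) I is invertible, and the function α1 ↦ −(Bα1 + Fθ)ᵀ E (Bα1 + Fθ) − (λ/2) α1ᵀ R⁻¹ α1 on ℝ^m attains its unique maximum at α1* = −(R BᵀEB + (λ/2) I)⁻¹ R Bᵀ E F θ. -/
open Matrix

/-- Expansion of a real quadratic form around a point. -/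
theorem Matrix.IsSymm.quadratic_add {ι : Type*} [Fintype ι] {A : Matrix ι ι ℝ} (hA : A.IsSymm)
    (x d : ι → ℝ) :
    (x + d) ⬝ᵥ (A *ᵥ (x + d)) =
      x ⬝ᵥ (A *ᵥ x) + 2 * (d ⬝ᵥ (A *ᵥ x)) + d ⬝ᵥ (A *ᵥ d) := by
  have h : x ⬝ᵥ (A *ᵥ d) = d ⬝ᵥ (A *ᵥ x) := by
    rw [dotProduct_mulVec, ← mulVec_transpose, hA.eq, dotProduct_comm]
  simp only [mulVec_add, add_dotProduct, dotProduct_add, h]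
  ring

/-- Completing the square: around a stationary point `x`, the sum of two quadratic terms changes
only by its purely quadratic part. -/
theorem Matrix.IsSymm.quadratic_add_quadratic_of_stationary {ι κ : Type*} [Fintype ι] [Fintype κ]
    {E : Matrix ι ι ℝ} {S : Matrix κ κ ℝ} (hE : E.IsSymm) (hS : S.IsSymm) (B : Matrix ι κ ℝ)
    (f : ι → ℝ) (c : ℝ) {x : κ → ℝ} (hx : (Bᵀ * E * B + c • S) *ᵥ x = -((Bᵀ * E) *ᵥ f))
    (d : κ → ℝ) :
    (B *ᵥ (x + d) + f) ⬝ᵥ (E *ᵥ (B *ᵥ (x + d) + f)) + c * ((x + d) ⬝ᵥ (S *ᵥ (x + d))) =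
      (B *ᵥ x + f) ⬝ᵥ (E *ᵥ (B *ᵥ x + f)) + c * (x ⬝ᵥ (S *ᵥ x)) +
        d ⬝ᵥ ((Bᵀ * E * B + c • S) *ᵥ d) := by
  have pull (v : ι → ℝ) : (B *ᵥ d) ⬝ᵥ v = d ⬝ᵥ (Bᵀ *ᵥ v) := by
    rw [dotProduct_mulVec, vecMul_transpose]
  have hcross := congrArg (d ⬝ᵥ ·) hx
  rw [show B *ᵥ (x + d) + f = (B *ᵥ x + f) + B *ᵥ d by rw [mulVec_add]; abel,
    hE.quadratic_add, hS.quadratic_add, pull, pull]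
  simp only [mulVec_add, add_mulVec, smul_mulVec, dotProduct_add, dotProduct_smul,
    dotProduct_neg, mulVec_mulVec, smul_eq_mul, Matrix.mul_assoc] at hcross ⊢
  linear_combination 2 * hcross

/-- last claim of Proposition 3: `max_{α1} V_F(1, λ, α1, 0)` is
attained uniquely at `α1* = −(R BᵀEB + (λ/2) I)⁻¹ R Bᵀ E F θ`. -/
theorem stmt12 {n m : ℕ} (hn : 1 ≤ n) (hm : 1 ≤ m)
    (B : Matrix (Fin n) (Fin m) ℝ) (hB : LinearIndependent ℝ Bᵀ)
    (E : Matrix (Fin n) (Fin n) ℝ) (hE : E.PosDef)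
    (R : Matrix (Fin m) (Fin m) ℝ) (hR : R.PosDef)
    (f : Fin n → ℝ) (lam : ℝ) (hlam : 0 < lam)
    (g : (Fin m → ℝ) → ℝ)
    (hg : ∀ α1, g α1 =
      -((B *ᵥ α1 + f) ⬝ᵥ (E *ᵥ (B *ᵥ α1 + f))) -
        lam / 2 * (α1 ⬝ᵥ (R⁻¹ *ᵥ α1))) :
    IsUnit (R * Bᵀ * E * B + (lam / 2) • (1 : Matrix (Fin m) (Fin m) ℝ)) ∧
    (∀ α1 : Fin m → ℝ,
      g α1 ≤ g (-(((R * Bᵀ * E * B + (lam / 2) • 1)⁻¹ * R * Bᵀ * E) *ᵥ f))) ∧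
    ∀ α1 : Fin m → ℝ,
      g α1 = g (-(((R * Bᵀ * E * B + (lam / 2) • 1)⁻¹ * R * Bᵀ * E) *ᵥ f)) →
        α1 = -(((R * Bᵀ * E * B + (lam / 2) • 1)⁻¹ * R * Bᵀ * E) *ᵥ f) := by
  set M := R * Bᵀ * E * B + (lam / 2) • (1 : Matrix (Fin m) (Fin m) ℝ)
  set P := Bᵀ * E * B + (lam / 2) • R⁻¹ with hP_def
  have hRdet : IsUnit R.det := (isUnit_iff_isUnit_det R).1 hR.isUnit
  have hP : P.PosDef := by
    have hBEB : (Bᵀ * E * B).PosSemidef := by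
      simpa using hE.posSemidef.conjTranspose_mul_mul_same B
    exact (hR.inv.smul (half_pos hlam)).posSemidef_add hBEB
  have hM : M = R * P := by
    simp only [M, P, Matrix.mul_add, Matrix.mul_smul, mul_nonsing_inv R hRdet, Matrix.mul_assoc]
  have hPdet : IsUnit P.det := (isUnit_iff_isUnit_det P).1 hP.isUnit
  have hsol : P * (M⁻¹ * R * Bᵀ * E) = Bᵀ * E := by
    rw [hM, Matrix.mul_inv_rev]
    simp only [Matrix.mul_assoc]
    rw [mul_nonsing_inv_cancel_left _ _ hPdet, nonsing_inv_mul_cancel_left _ _ hRdet]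
  set x := -((M⁻¹ * R * Bᵀ * E) *ᵥ f)
  have hx : P *ᵥ x = -((Bᵀ * E) *ᵥ f) := by
    rw [mulVec_neg, mulVec_mulVec, hsol]
  have hEsymm : E.IsSymm := by simpa using hE.isHermitian
  have hRsymm : R⁻¹.IsSymm := by simpa using hR.inv.isHermitian
  have key (a : Fin m → ℝ) : g a = g x - (a - x) ⬝ᵥ (P *ᵥ (a - x)) := by
    have h := hEsymm.quadratic_add_quadratic_of_stationary hRsymm B f (lam / 2) hx (a - x)
    rw [add_sub_cancel, ← hP_def] at h
    rw [hg, hg]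
    linarith
  refine ⟨hM ▸ hR.isUnit.mul hP.isUnit, fun a => ?_, fun a ha => ?_⟩
  · have h := hP.posSemidef.dotProduct_mulVec_nonneg (a - x)
    rw [star_trivial] at h
    linarith [key a]
  · by_contra hne
    have h := hP.dotProduct_mulVec_pos (sub_ne_zero.2 hne)
    rw [star_trivial] at h
    linarith [key a]
end

section
/- Let S ⊂ ℝ^{2×2} × ℝ^{2×2} be the set of pairs (α, β) of 2×2 matrices with strictly positive entries such that the entries of α sum to 1 and the entries of β sum to 1, and define q(α, β) = ∑_{x=1}^{2} ∑_{u=1}^{2} α_{x,u} · ln[ (α_{x,u} / (α_{x,1} + α_{x,2})) / (β_{x,u} / (β_{x,1} + β_{x,2})) ]. Then q is not convex on S: there exist (α, β) ∈ S, (α', β') ∈ S and λ ∈ (0,1) such that λ q(α, β) + (1−λ) q(α', β') < q(λα + (1−λ)α', λβ + (1−λ)β'). -/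
/-- The expected policy KL divergence in occupation-measure variables,
`q(α,β) = ∑_{x,u} α_{x,u} ln[(α_{x,u}/‖α_{x,*}‖₁)/(β_{x,u}/‖β_{x,*}‖₁)]`,
for pairs of 2×2 matrices. -/
noncomputable def qFun (α β : Matrix (Fin 2) (Fin 2) ℝ) : ℝ :=
  ∑ x, ∑ u, α x u *
    Real.log ((α x u / (α x 0 + α x 1)) / (β x u / (β x 0 + β x 1)))

/-- Membership in `S`: both matrices have strictly positive entries summing to 1. -/
def memS (α β : Matrix (Fin 2) (Fin 2) ℝ) : Prop :=
  (∀ x u, 0 < α x u) ∧ (∑ x, ∑ u, α x u = 1) ∧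
    (∀ x u, 0 < β x u) ∧ (∑ x, ∑ u, β x u = 1)

/-- Appendix of the paper: `q` is not convex on the convex set `S`
of pairs of strictly positive probability matrices. -/
theorem stmt17 :
    ∃ (α β α' β' : Matrix (Fin 2) (Fin 2) ℝ) (lam : ℝ),
      memS α β ∧ memS α' β' ∧ lam ∈ Set.Ioo (0 : ℝ) 1 ∧
      lam * qFun α β + (1 - lam) * qFun α' β' <
        qFun (lam • α + (1 - lam) • α') (lam • β + (1 - lam) • β') := by
  have hlog : Real.log (3 / 5) < Real.log (5 / 3) :=
    Real.log_lt_log (by norm_num) (by norm_num)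
  have hinv : Real.log (3 / 5) = -Real.log (5 / 3) := by
    rw [← Real.log_inv]
    norm_num
  -- The two policies agree at both endpoints, so `q` vanishes there, but not at the midpoint.
  refine ⟨!![3 / 16, 1 / 16; 3 / 8, 3 / 8], !![9 / 16, 3 / 16; 1 / 8, 1 / 8],
    !![3 / 16, 9 / 16; 1 / 8, 1 / 8], !![1 / 16, 3 / 16; 3 / 8, 3 / 8], 1 / 2,
    ?_, ?_, by norm_num, ?_⟩
  · simp only [memS, Fin.forall_fin_two, Fin.sum_univ_two]
    norm_num
  · simp only [memS, Fin.forall_fin_two, Fin.sum_univ_two]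
    norm_num
  · simp only [qFun, Fin.sum_univ_two, Matrix.add_apply, Matrix.smul_apply, smul_eq_mul]
    norm_num
    linarith
end
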